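/- For all n ≥ 1: (i) the characteristic polynomial of the bond lattice Π_{Γ_{2n}} evaluated at −1 equals minus the number of D-permutations on [2n], i.e., χ_{2n}(−1) = −|D_{2n}|; and (ii) the Möbius function of Π_{Γ_{2n}} between its minimum element 0̂ and its maximum element 1̂ (the one-block partition) equals minus the number of D-cycles on [2n], i.e., μ(0̂, 1̂) = −|DC_{2n}|. -/

import Mathlib

open Finset

/-- The Ferrers graph on vertex set `V ⊆ ℕ`: edges `{u,v}` with `u < v`, `u` odd, `v` even. -/
def ferrers (V : Finset ℕ) : SimpleGraph ℕ :=
  SimpleGraph.fromRel (fun u v => u ∈ V ∧ v ∈ V ∧ u < v ∧ Odd u ∧ Even v)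

/-- A partition of `V` is a bond partition if each block induces a connected subgraph. -/
def IsBond (V : Finset ℕ) (P : Finpartition V) : Prop :=
  ∀ B ∈ P.parts, ((ferrers V).induce (B : Set ℕ)).Connected

/-- `u` is a (strict) descendant of `v` in the graph `G` rooted (componentwise) at `r`. -/
def DescOf {α : Type*} (G : SimpleGraph α) (r v u : α) : Prop :=
  u ≠ v ∧ G.Reachable u r ∧ ∀ p : G.Walk u r, v ∈ p.support

/-- `F` is an increasing-decreasing (ID) forest. -/
def IsIDForest (V : Finset ℕ) (F : SimpleGraph {x // x ∈ V}) : Prop :=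
  F.IsAcyclic ∧
  ∀ r v : {x // x ∈ V}, F.Reachable v r → (∀ u, F.Reachable v u → (u : ℕ) ≤ (r : ℕ)) →
    (Odd (v : ℕ) →
      (∀ u, DescOf F r v u → (v : ℕ) < (u : ℕ)) ∧
      (∀ u, F.Adj v u → DescOf F r v u → Even (u : ℕ))) ∧
    (Even (v : ℕ) →
      (∀ u, DescOf F r v u → (u : ℕ) < (v : ℕ)) ∧
      (∀ u, F.Adj v u → DescOf F r v u → Odd (u : ℕ)))

/-- `T` is an increasing-decreasing (ID) tree. -/
def IsIDTree (V : Finset ℕ) (T : SimpleGraph {x // x ∈ V}) : Prop :=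
  T.Connected ∧ IsIDForest V T

/-- A D-permutation on `A`. -/
def IsDPerm (A : Finset ℕ) (σ : Equiv.Perm {x // x ∈ A}) : Prop :=
  ∀ i : {x // x ∈ A}, (Odd (i : ℕ) → (i : ℕ) ≤ (σ i : ℕ)) ∧ (Even (i : ℕ) → (σ i : ℕ) ≤ (i : ℕ))

/-- A D-cycle on `A`: a D-permutation which is a single cycle covering `A`. -/
def IsDCycle (A : Finset ℕ) (σ : Equiv.Perm {x // x ∈ A}) : Prop :=
  IsDPerm A σ ∧ ∀ x y : {x // x ∈ A}, σ.SameCycle x y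

/-- The number of cycles (orbits, fixed points included) of a permutation. -/
noncomputable def cycleCount {α : Type*} (σ : Equiv.Perm α) : ℕ :=
  Nat.card (Quotient (⟨σ.SameCycle, Equiv.Perm.SameCycle.equivalence σ⟩ : Setoid α))

/-- A Dumont permutation on `A` (intended for `A = [2m]`). -/
def IsDumontPerm (A : Finset ℕ) (σ : Equiv.Perm {x // x ∈ A}) : Prop :=
  ∀ i : {x // x ∈ A}, (Even (i : ℕ) → (σ i : ℕ) < (i : ℕ)) ∧ (Odd (i : ℕ) → (i : ℕ) ≤ (σ i : ℕ))

/-- A Dumont derangement on `A` (intended for `A = [2m]`). -/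
def IsDumontDerangement (A : Finset ℕ) (σ : Equiv.Perm {x // x ∈ A}) : Prop :=
  ∀ i : {x // x ∈ A}, (Even (i : ℕ) → (σ i : ℕ) < (i : ℕ)) ∧ (Odd (i : ℕ) → (i : ℕ) < (σ i : ℕ))

/-- The Genocchi number `g n`: the number of Dumont permutations on `[2n-2]`. -/
noncomputable def genocchi (n : ℕ) : ℕ :=
  Nat.card {σ : Equiv.Perm {x // x ∈ Finset.Icc 1 (2 * n - 2)} // IsDumontPerm _ σ}

/-- The median Genocchi number `h n`: the number of Dumont derangements on `[2n+2]`. -/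
noncomputable def medianGenocchi (n : ℕ) : ℕ :=
  Nat.card {σ : Equiv.Perm {x // x ∈ Finset.Icc 1 (2 * n + 2)} // IsDumontDerangement _ σ}

open scoped Classical

namespace Finpartition

variable {V : Finset ℕ}

lemma le_iff_part_eq {P Q : Finpartition V} :
    P ≤ Q ↔ ∀ x ∈ V, ∀ y ∈ V, P.part x = P.part y → Q.part x = Q.part y := by
  constructor
  · intro h x hx y hy hxy
    obtain ⟨t, ht, hle⟩ := h (P.part_mem.2 hx)
    rw [Q.part_eq_of_mem ht (hle (P.mem_part hx)),
      Q.part_eq_of_mem ht (hle (by rw [hxy]; exact P.mem_part hy))]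
  · intro h t ht
    obtain ⟨x, hx⟩ := P.nonempty_of_mem_parts ht
    have hxV := P.le ht hx
    refine ⟨Q.part x, Q.part_mem.2 hxV, fun y hy => ?_⟩
    have hyV := P.le ht hy
    rw [h x hxV y hyV (by rw [P.part_eq_of_mem ht hx, P.part_eq_of_mem ht hy])]
    exact Q.mem_part hyV

lemma part_bot {x : ℕ} (hx : x ∈ V) : (⊥ : Finpartition V).part x = {x} :=
  part_eq_of_mem _ (by simpa using hx) (by simp)

end Finpartition

section Orbits

variable {V : Finset ℕ}

/-- The partition of `V` into the orbits of a permutation. -/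
noncomputable def orbitPartition (σ : Equiv.Perm {x // x ∈ V}) : Finpartition V :=
  Finpartition.ofSetSetoid (Equiv.Perm.SameCycle.setoid (Equiv.Perm.ofSubtype σ)) V

lemma sameCycle_ofSubtype (σ : Equiv.Perm {x // x ∈ V}) (x y : {x // x ∈ V}) :
    (Equiv.Perm.ofSubtype σ).SameCycle x y ↔ σ.SameCycle x y := by
  have h (k : ℤ) : ((Equiv.Perm.ofSubtype σ ^ k) (x : ℕ)) = ((σ ^ k) x : {x // x ∈ V}) := by
    rw [← map_zpow, Equiv.Perm.ofSubtype_apply_coe]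
  simp only [Equiv.Perm.SameCycle, h, Subtype.coe_inj]

lemma part_orbitPartition_eq_iff (σ : Equiv.Perm {x // x ∈ V}) (x y : {x // x ∈ V}) :
    (orbitPartition σ).part x = (orbitPartition σ).part y ↔ σ.SameCycle x y := by
  rw [← (orbitPartition σ).mem_part_iff_part_eq_part x.2 y.2, orbitPartition,
    Finpartition.mem_part_ofSetSetoid_iff_rel]
  have : (Equiv.Perm.SameCycle.setoid (Equiv.Perm.ofSubtype σ)) y x ↔ σ.SameCycle x y :=
    (sameCycle_ofSubtype σ y x).trans Equiv.Perm.sameCycle_comm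
  simp [this]

lemma orbitPartition_le_iff (σ : Equiv.Perm {x // x ∈ V}) (b : Finpartition V) :
    orbitPartition σ ≤ b ↔ ∀ x : {x // x ∈ V}, b.part x = b.part (σ x) := by
  rw [Finpartition.le_iff_part_eq]
  constructor
  · intro h x
    exact h x x.2 _ (σ x).2 ((part_orbitPartition_eq_iff σ x (σ x)).2
      (Equiv.Perm.sameCycle_apply_right.2 (.refl _ _)))
  · intro h x hx y hy hxy
    obtain ⟨k, hk⟩ := ((part_orbitPartition_eq_iff σ ⟨x, hx⟩ ⟨y, hy⟩).1 hxy).exists_nat_pow_eq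
    have key (m : ℕ) : b.part x = b.part ((σ ^ m) ⟨x, hx⟩ : {x // x ∈ V}) := by
      induction m with
      | zero => simp
      | succ m ih => rw [ih, pow_succ', Equiv.Perm.mul_apply]; exact h _
    rw [key k, hk]

lemma card_image_eq_card_image {α β γ : Type*} [DecidableEq β] [DecidableEq γ]
    (s : Finset α) (f : α → β) (g : α → γ)
    (h : ∀ x y, f x = f y ↔ g x = g y) : #(s.image f) = #(s.image g) := by
  induction s using Finset.induction_on with
  | empty => simp
  | insert a s ha ih =>
    simp only [Finset.image_insert, Finset.card_insert_eq_ite, Finset.mem_image, h, ih]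

lemma card_parts_orbitPartition (σ : Equiv.Perm {x // x ∈ V}) :
    #(orbitPartition σ).parts = #σ.cycleFactorsFinset + #(σ.supportᶜ) := by
  let h : {x // x ∈ V} → Equiv.Perm {x // x ∈ V} ⊕ {x // x ∈ V} := fun x =>
    if σ x = x then .inr x else .inl (σ.cycleOf x)
  have h1 : (orbitPartition σ).parts =
      (Finset.univ : Finset {x // x ∈ V}).image
        fun x : {x // x ∈ V} => (orbitPartition σ).part x := by
    ext p
    simp only [Finset.mem_image, Finset.mem_univ, true_and, Subtype.exists]
    constructor
    · intro hp
      obtain ⟨x, hx⟩ := (orbitPartition σ).nonempty_of_mem_parts hp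
      exact ⟨x, (orbitPartition σ).le hp hx, (orbitPartition σ).part_eq_of_mem hp hx⟩
    · rintro ⟨x, hx, rfl⟩
      exact (orbitPartition σ).part_mem.2 hx
  have h2 (x y : {x // x ∈ V}) :
      (orbitPartition σ).part x = (orbitPartition σ).part y ↔ h x = h y := by
    rw [part_orbitPartition_eq_iff]
    by_cases hx : σ x = x <;> by_cases hy : σ y = y
    · simp only [h, hx, hy, if_true, Sum.inr.injEq]
      exact ⟨fun hc => hc.eq_of_left hx, fun hc => hc ▸ .refl _ _⟩
    · simp only [h, hx, hy, if_true, if_false, reduceCtorEq, iff_false]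
      exact fun hc => hy (hc.apply_eq_self_iff.1 hx)
    · simp only [h, hx, hy, if_true, if_false, reduceCtorEq, iff_false]
      exact fun hc => hx (hc.apply_eq_self_iff.2 hy)
    · simp only [h, hx, hy, if_false, Sum.inl.injEq]
      refine ⟨fun hc => hc.cycleOf_eq, fun hc => ?_⟩
      exact (Equiv.Perm.sameCycle_iff_cycleOf_eq_of_mem_support
        (Equiv.Perm.mem_support.2 hx) (Equiv.Perm.mem_support.2 hy)).2 hc
  have h3 : Finset.univ.image h = σ.cycleFactorsFinset.disjSum σ.supportᶜ := by
    ext (c | x)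
    · simp only [Finset.mem_image, Finset.mem_univ, true_and, Finset.inl_mem_disjSum]
      constructor
      · rintro ⟨x, hx⟩
        by_cases hσ : σ x = x
        · simp [h, hσ] at hx
        · simp only [h, hσ, if_false, Sum.inl.injEq] at hx
          rw [← hx, Equiv.Perm.cycleOf_mem_cycleFactorsFinset_iff]
          exact Equiv.Perm.mem_support.2 hσ
      · intro hc
        obtain ⟨x, hx⟩ := (Equiv.Perm.mem_cycleFactorsFinset_iff.1 hc).1.nonempty_support
        refine ⟨x, ?_⟩
        have hσ := Equiv.Perm.mem_support.1 (Equiv.Perm.mem_cycleFactorsFinset_support_le hc hx)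
        simp [h, hσ, Equiv.Perm.cycle_is_cycleOf hx hc]
    · simp only [Finset.mem_image, Finset.mem_univ, true_and, Finset.inr_mem_disjSum,
        Finset.mem_compl, Equiv.Perm.mem_support, not_not]
      constructor
      · rintro ⟨y, hy⟩
        by_cases hσ : σ y = y
        · simp only [h, hσ, if_true, Sum.inr.injEq] at hy
          exact hy ▸ hσ
        · simp [h, hσ] at hy
      · intro hx
        exact ⟨x, by simp [h, hx]⟩
  rw [h1, card_image_eq_card_image _ _ h h2, h3, Finset.card_disjSum]

lemma sign_eq_neg_one_pow_card_parts (σ : Equiv.Perm {x // x ∈ V}) :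
    (Equiv.Perm.sign σ : ℤ) = (-1) ^ (#V + #(orbitPartition σ).parts) := by
  have h1 := Finset.card_add_card_compl σ.support
  rw [Fintype.card_coe] at h1
  have h2 : #σ.cycleFactorsFinset = Multiset.card σ.cycleType := by
    simp [Equiv.Perm.cycleType_def]
  rw [Equiv.Perm.sign_of_cycleType, Equiv.Perm.sum_cycleType, card_parts_orbitPartition, ← h1, h2]
  push_cast
  rw [show #σ.support + #σ.supportᶜ + (Multiset.card σ.cycleType + #σ.supportᶜ) =
    #σ.support + Multiset.card σ.cycleType + 2 * #σ.supportᶜ by ring, pow_add _ _ (2 * _), pow_mul]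
  simp

end Orbits

section Bond

variable {V : Finset ℕ}

lemma ferrers_adj_of_lt {u v : ℕ} (hu : u ∈ V) (hv : v ∈ V) (huv : u < v) (ho : Odd u)
    (he : Even v) : (ferrers V).Adj u v :=
  ⟨huv.ne, Or.inl ⟨hu, hv, huv, ho, he⟩⟩

lemma ferrers_induce_connected {B : Finset ℕ} (hB : B ⊆ V) {m M : ℕ} (hm : m ∈ B) (hM : M ∈ B)
    (hmo : Odd m) (hMe : Even M) (hmin : ∀ x ∈ B, m ≤ x) (hmax : ∀ x ∈ B, x ≤ M) :
    ((ferrers V).induce (B : Set ℕ)).Connected := by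
  have adj (u v : ℕ) (hu : u ∈ B) (hv : v ∈ B) (huv : u ≤ v) (ho : Odd u) (he : Even v) :
      ((ferrers V).induce (B : Set ℕ)).Adj ⟨u, hu⟩ ⟨v, hv⟩ :=
    ferrers_adj_of_lt (hB hu) (hB hv)
      (huv.lt_of_ne fun h => Nat.not_even_iff_odd.2 ho (h ▸ he)) ho he
  have reach (x : (B : Set ℕ)) : ((ferrers V).induce (B : Set ℕ)).Reachable ⟨m, hm⟩ x := by
    obtain ⟨x, hx⟩ := x
    rcases Nat.even_or_odd x with he | ho
    · exact (adj m x hm hx (hmin x hx) hmo he).reachable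
    · exact (adj m M hm hM (hmin M hM) hmo hMe).reachable.trans
        (adj x M hx hM (hmax x hx) ho hMe).symm.reachable
  exact (SimpleGraph.connected_iff_exists_forall_reachable _).2 ⟨⟨m, hm⟩, reach⟩

lemma isBond_bot : IsBond V ⊥ := by
  intro B hB
  obtain ⟨x, -, rfl⟩ : ∃ x ∈ V, {x} = B := by simpa using hB
  have : Subsingleton ((({x} : Finset ℕ) : Set ℕ)) := by
    simp only [Finset.coe_singleton]; infer_instance
  exact (SimpleGraph.connected_iff _).2 ⟨SimpleGraph.Preconnected.of_subsingleton, ⟨⟨x, by simp⟩⟩⟩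

lemma isBond_orbitPartition {σ : Equiv.Perm {x // x ∈ V}} (hσ : IsDPerm V σ) :
    IsBond V (orbitPartition σ) := by
  intro B hB
  have hBV := (orbitPartition σ).le hB
  have hne := (orbitPartition σ).nonempty_of_mem_parts hB
  have hstep (x : {x // x ∈ V}) : (x : ℕ) ∈ B ↔ (σ x : ℕ) ∈ B := by
    rw [← (orbitPartition σ).part_eq_iff_mem hB, ← (orbitPartition σ).part_eq_iff_mem hB,
      (part_orbitPartition_eq_iff σ x (σ x)).2 (Equiv.Perm.sameCycle_apply_right.2 (.refl _ _))]
  have hfix (x : {x // x ∈ V}) (hx : (x : ℕ) ∈ B) (h : σ x = x) (y : ℕ) (hy : y ∈ B) :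
      (x : ℕ) = y := by
    have h1 : σ.SameCycle x ⟨y, hBV hy⟩ := (part_orbitPartition_eq_iff σ _ _).1
      (((orbitPartition σ).part_eq_of_mem hB hx).trans
        ((orbitPartition σ).part_eq_of_mem hB hy).symm)
    exact congrArg Subtype.val (h1.eq_of_left h)
  by_cases hsub : ∃ x : {x // x ∈ V}, (x : ℕ) ∈ B ∧ σ x = x
  · obtain ⟨x, hx, h⟩ := hsub
    have : Subsingleton (B : Set ℕ) :=
      ⟨fun a b => Subtype.ext ((hfix x hx h a a.2).symm.trans (hfix x hx h b b.2))⟩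
    exact (SimpleGraph.connected_iff _).2 ⟨SimpleGraph.Preconnected.of_subsingleton, ⟨⟨x, hx⟩⟩⟩
  push Not at hsub
  have hm := B.min'_mem hne
  have hM := B.max'_mem hne
  refine ferrers_induce_connected hBV hm hM ?_ ?_ (fun x => B.min'_le x) (fun x => B.le_max' x)
  · by_contra ho
    refine hsub ⟨_, hBV hm⟩ hm (Subtype.ext (le_antisymm ?_ ?_))
    · exact (hσ ⟨_, hBV hm⟩).2 (Nat.not_odd_iff_even.1 ho)
    · exact B.min'_le _ ((hstep ⟨_, hBV hm⟩).1 hm)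
  · by_contra he
    refine hsub ⟨_, hBV hM⟩ hM (Subtype.ext (le_antisymm ?_ ?_))
    · exact B.le_max' _ ((hstep ⟨_, hBV hM⟩).1 hM)
    · exact (hσ ⟨_, hBV hM⟩).1 (Nat.not_even_iff_odd.1 he)

lemma exists_consecutive_odd_even {B : Finset ℕ} {u v : ℕ} (hu : u ∈ B) (hv : v ∈ B)
    (huv : u < v) (ho : Odd u) (he : Even v) :
    ∃ u ∈ B, ∃ v ∈ B, u < v ∧ Odd u ∧ Even v ∧ ∀ w ∈ B, ¬ (u < w ∧ w < v) := by
  induction hk : v - u using Nat.strong_induction_on generalizing u v with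
  | _ k ih =>
    by_cases h : ∃ w ∈ B, u < w ∧ w < v
    · obtain ⟨w, hw, h1, h2⟩ := h
      rcases Nat.even_or_odd w with hwe | hwo
      · exact ih (w - u) (by omega) hu hw h1 ho hwe rfl
      · exact ih (v - w) (by omega) hw hv h2 hwo he rfl
    · push Not at h
      exact ⟨u, hu, v, hv, huv, ho, he, fun w hw hw' => absurd hw'.2 (h w hw hw'.1).not_gt⟩

lemma IsBond.exists_consecutive {b : Finpartition V} (hb : IsBond V b) (hne : b ≠ ⊥) :
    ∃ B ∈ b.parts, ∃ u ∈ B, ∃ v ∈ B, u < v ∧ Odd u ∧ Even v ∧ ∀ w ∈ B, ¬ (u < w ∧ w < v) := by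
  have h1 : ¬ b ≤ ⊥ := fun h => hne (le_bot_iff.1 h)
  rw [Finpartition.le_iff_part_eq] at h1
  push Not at h1
  obtain ⟨x, hx, y, hy, hxy, hxy'⟩ := h1
  have hB := b.part_mem.2 hx
  refine ⟨b.part x, hB, ?_⟩
  have hyB : y ∈ b.part x := by rw [hxy]; exact b.mem_part hy
  obtain ⟨p⟩ := (hb _ hB).preconnected ⟨x, b.mem_part hx⟩ ⟨y, hyB⟩
  cases p with
  | nil => exact absurd rfl hxy'
  | @cons _ w _ hadj _ =>
    rcases hadj.2 with ⟨-, -, hlt, ho, he⟩ | ⟨-, -, hlt, ho, he⟩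
    · exact exists_consecutive_odd_even (b.mem_part hx) w.2 hlt ho he
    · exact exists_consecutive_odd_even w.2 (b.mem_part hx) hlt ho he

end Bond

section SignedSum

variable {V : Finset ℕ}

/-- The signed number of D-permutations whose orbit partition is `c`. -/
noncomputable def signedCount (c : Finpartition V) : ℤ :=
  ∑ σ : Equiv.Perm {x // x ∈ V} with IsDPerm V σ ∧ orbitPartition σ = c, (Equiv.Perm.sign σ : ℤ)

/-- Permutation expansion of the determinant of this matrix runs over the D-permutations which
preserve the blocks of `b`. -/
noncomputable def blockMatrix (b : Finpartition V) : Matrix {x // x ∈ V} {x // x ∈ V} ℤ :=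
  fun r c => if ((Odd (c : ℕ) → (c : ℕ) ≤ r) ∧ (Even (c : ℕ) → (r : ℕ) ≤ c)) ∧
    b.part c = b.part r then 1 else 0

lemma det_blockMatrix_eq_sum (b : Finpartition V) :
    (blockMatrix b).det = ∑ σ : Equiv.Perm {x // x ∈ V} with IsDPerm V σ ∧ orbitPartition σ ≤ b,
      (Equiv.Perm.sign σ : ℤ) := by
  rw [Matrix.det_apply, Finset.sum_filter]
  refine Finset.sum_congr rfl fun σ _ => ?_
  have h : (∏ i, blockMatrix b (σ i) i) = if IsDPerm V σ ∧ orbitPartition σ ≤ b then 1 else 0 := by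
    simp only [blockMatrix, Finset.prod_boole, Finset.mem_univ, forall_true_left,
      orbitPartition_le_iff, IsDPerm, forall_and]
  rw [h]
  split_ifs <;> simp [Units.smul_def]

lemma det_blockMatrix_bot : (blockMatrix (⊥ : Finpartition V)).det = 1 := by
  have : blockMatrix (⊥ : Finpartition V) = 1 := by
    ext i j
    simp only [blockMatrix, Finpartition.part_bot i.2, Finpartition.part_bot j.2,
      Finset.singleton_inj, Subtype.coe_inj, Matrix.one_apply]
    by_cases h : i = j
    · subst h; simp
    · simp [h, Ne.symm h]
  rw [this, Matrix.det_one]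

lemma IsBond.det_blockMatrix_eq_zero {b : Finpartition V} (hb : IsBond V b) (hne : b ≠ ⊥) :
    (blockMatrix b).det = 0 := by
  obtain ⟨B, hB, u, hu, v, hv, huv, ho, he, hcons⟩ := hb.exists_consecutive hne
  refine Matrix.det_zero_of_row_eq (i := ⟨u, b.le hB hu⟩) (j := ⟨v, b.le hB hv⟩)
    (fun h => huv.ne (congrArg Subtype.val h)) ?_
  ext c
  simp only [blockMatrix, b.part_eq_of_mem hB hu, b.part_eq_of_mem hB hv]
  refine if_congr (and_congr_left fun hc => ?_) rfl rfl
  have hcB := (b.part_eq_iff_mem hB).1 hc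
  have hw := hcons c hcB
  obtain ⟨k, hk⟩ := ho
  obtain ⟨l, hl⟩ := he
  refine and_congr (forall_congr' ?_) (forall_congr' ?_)
  · rintro ⟨m, hm⟩; omega
  · rintro ⟨m, hm⟩; omega

lemma sum_fiberwise_signedCount (s : Finset (Finpartition V)) (f : Finpartition V → ℤ) :
    ∑ c ∈ s, signedCount c * f c =
      ∑ σ : Equiv.Perm {x // x ∈ V} with IsDPerm V σ ∧ orbitPartition σ ∈ s,
        (Equiv.Perm.sign σ : ℤ) * f (orbitPartition σ) := by
  simp only [signedCount, Finset.sum_filter, Finset.sum_mul]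
  rw [Finset.sum_comm]
  refine Finset.sum_congr rfl fun σ _ => ?_
  by_cases h : IsDPerm V σ <;> simp [h, ite_mul, Finset.sum_ite_eq]

lemma IsBond.sum_signedCount {b : Finpartition V} (hb : IsBond V b) :
    ∑ c with IsBond V c ∧ ⊥ ≤ c ∧ c ≤ b, signedCount c = if ⊥ = b then 1 else 0 := by
  have h1 : ∑ c with IsBond V c ∧ ⊥ ≤ c ∧ c ≤ b, signedCount c = (blockMatrix b).det := by
    have := sum_fiberwise_signedCount
      (Finset.univ.filter fun c : Finpartition V => IsBond V c ∧ ⊥ ≤ c ∧ c ≤ b) (fun _ => 1)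
    simp only [mul_one] at this
    rw [this, det_blockMatrix_eq_sum]
    refine Finset.sum_congr (Finset.filter_congr fun σ _ => ?_) fun _ _ => rfl
    simp only [Finset.mem_filter, Finset.mem_univ, true_and, bot_le]
    exact and_congr_right fun hσ => and_iff_right (isBond_orbitPartition hσ)
  rw [h1]
  split_ifs with h
  · rw [← h, det_blockMatrix_bot]
  · exact hb.det_blockMatrix_eq_zero (Ne.symm h)

lemma IsBond.moebius_eq_signedCount {μ : Finpartition V → ℤ}
    (hμ : ∀ b, IsBond V b →
      ∑ c with IsBond V c ∧ ⊥ ≤ c ∧ c ≤ b, μ c = if ⊥ = b then 1 else 0)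
    {b : Finpartition V} (hb : IsBond V b) : μ b = signedCount b := by
  induction b using WellFoundedLT.induction with
  | _ b ih =>
    have h := (hμ b hb).trans hb.sum_signedCount.symm
    have hmem : b ∈ Finset.univ.filter fun c : Finpartition V => IsBond V c ∧ ⊥ ≤ c ∧ c ≤ b := by
      simp [hb]
    rw [← Finset.add_sum_erase _ _ hmem, ← Finset.add_sum_erase _ _ hmem] at h
    rw [Finset.sum_congr rfl (g := signedCount)] at h
    · exact add_right_cancel h
    · intro c hc
      simp only [Finset.mem_erase, Finset.mem_filter, Finset.mem_univ, true_and] at hc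
      exact ih c (lt_of_le_of_ne hc.2.2.2 hc.1) hc.2.1

lemma neg_one_pow_card_add_mul (hV : Even #V) (hne : V.Nonempty) (P : Finpartition V) :
    (-1 : ℤ) ^ (#V + #P.parts) * (-1) ^ (#P.parts - 1) = -1 := by
  have : 0 < #P.parts := Finset.card_pos.2 (P.parts_nonempty hne.ne_empty)
  rw [← pow_add]
  exact Odd.neg_one_pow (by obtain ⟨k, hk⟩ := hV; exact ⟨k + #P.parts - 1, by omega⟩)

lemma sum_signedCount_mul_neg_one_pow (hV : Even #V) (hne : V.Nonempty) :
    ∑ P with IsBond V P, signedCount P * (-1 : ℤ) ^ (#P.parts - 1) =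
      -(Nat.card {σ : Equiv.Perm {x // x ∈ V} // IsDPerm V σ} : ℤ) := by
  rw [sum_fiberwise_signedCount, Nat.card_eq_fintype_card, Fintype.card_subtype]
  simp only [sign_eq_neg_one_pow_card_parts, neg_one_pow_card_add_mul hV hne]
  rw [Finset.sum_const, smul_neg, nsmul_one]
  congr 3
  refine Finset.filter_congr fun σ _ => ?_
  simpa using isBond_orbitPartition

lemma orbitPartition_eq_top_iff (σ : Equiv.Perm {x // x ∈ V}) :
    orbitPartition σ = ⊤ ↔ ∀ x y, σ.SameCycle x y := by
  have htop (x : ℕ) (hx : x ∈ V) : (⊤ : Finpartition V).part x = V :=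
    Finset.mem_singleton.1
      (Finpartition.parts_top_subset V ((⊤ : Finpartition V).part_mem.2 hx))
  rw [← top_le_iff, Finpartition.le_iff_part_eq]
  constructor
  · intro h x y
    exact (part_orbitPartition_eq_iff σ x y).1
      (h x x.2 y y.2 (by rw [htop x x.2, htop y y.2]))
  · intro h x hx y hy _
    exact (part_orbitPartition_eq_iff σ ⟨x, hx⟩ ⟨y, hy⟩).2 (h _ _)

lemma card_parts_top (hne : V.Nonempty) : #(⊤ : Finpartition V).parts = 1 :=
  le_antisymm ((Finset.card_le_card (Finpartition.parts_top_subset V)).trans (by simp))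
    (Finset.card_pos.2 (Finpartition.parts_nonempty _ hne.ne_empty))

lemma signedCount_top (hV : Even #V) (hne : V.Nonempty) :
    signedCount (⊤ : Finpartition V) =
      -(Nat.card {σ : Equiv.Perm {x // x ∈ V} // IsDCycle V σ} : ℤ) := by
  rw [Nat.card_eq_fintype_card, Fintype.card_subtype, signedCount,
    Finset.sum_congr rfl (g := fun _ => (-1 : ℤ))]
  · rw [Finset.sum_const, smul_neg, nsmul_one]
    congr 3
    exact Finset.filter_congr fun σ _ => and_congr_right fun _ => orbitPartition_eq_top_iff σ
  · intro σ hσ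
    rw [sign_eq_neg_one_pow_card_parts, (Finset.mem_filter.1 hσ).2.2, card_parts_top hne]
    exact Odd.neg_one_pow hV.add_one

end SignedSum

lemma isBond_top_Icc {n : ℕ} (hn : 1 ≤ n) :
    IsBond (Finset.Icc 1 (2 * n)) (⊤ : Finpartition (Finset.Icc 1 (2 * n))) := by
  intro B hB
  obtain rfl := Finset.mem_singleton.1 (Finpartition.parts_top_subset _ hB)
  refine ferrers_induce_connected subset_rfl (m := 1) (M := 2 * n) ?_ ?_ odd_one
    (even_two_mul n) ?_ ?_ <;> simp <;> omega

/-- (i) The characteristic polynomial of the bond lattice of `Γ_{2n}` evaluated at `-1` is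
minus the number of D-permutations on `[2n]`; (ii) `μ(0̂, 1̂) = -|DC_{2n}|`, where `1̂ = ⊤` is
the one-block partition.  Here `μ` is any function satisfying the defining recurrence of the
Möbius function of the bond lattice. -/
theorem stmt11 (n : ℕ) (hn : 1 ≤ n)
    (μ : Finpartition (Finset.Icc 1 (2 * n)) → Finpartition (Finset.Icc 1 (2 * n)) → ℤ)
    (hμ : ∀ a b : Finpartition (Finset.Icc 1 (2 * n)),
      IsBond (Finset.Icc 1 (2 * n)) a → IsBond (Finset.Icc 1 (2 * n)) b → a ≤ b →
      (∑ c ∈ Finset.univ.filter fun c => IsBond (Finset.Icc 1 (2 * n)) c ∧ a ≤ c ∧ c ≤ b,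
        μ a c) = if a = b then 1 else 0) :
    (∑ P ∈ Finset.univ.filter
        fun P : Finpartition (Finset.Icc 1 (2 * n)) => IsBond (Finset.Icc 1 (2 * n)) P,
        μ ⊥ P * (-1 : ℤ) ^ (P.parts.card - 1)) =
      -(Nat.card {σ : Equiv.Perm {x // x ∈ Finset.Icc 1 (2 * n)} //
          IsDPerm (Finset.Icc 1 (2 * n)) σ} : ℤ) ∧
    μ ⊥ ⊤ =
      -(Nat.card {σ : Equiv.Perm {x // x ∈ Finset.Icc 1 (2 * n)} //
          IsDCycle (Finset.Icc 1 (2 * n)) σ} : ℤ) := by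
  have hV : Even #(Finset.Icc 1 (2 * n)) := by simp
  have hne : (Finset.Icc 1 (2 * n)).Nonempty := Finset.nonempty_Icc.2 (by omega)
  have hcount {b : Finpartition (Finset.Icc 1 (2 * n))} (hb : IsBond _ b) :
      μ ⊥ b = signedCount b :=
    IsBond.moebius_eq_signedCount (fun b hb => hμ ⊥ b isBond_bot hb bot_le) hb
  refine ⟨?_, (hcount (isBond_top_Icc hn)).trans (signedCount_top hV hne)⟩
  rw [← sum_signedCount_mul_neg_one_pow hV hne]
  exact Finset.sum_congr rfl fun P hP => by rw [hcount (Finset.mem_filter.1 hP).2]
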